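/- arXiv:math/0703371 — 2 statements merged into one kernel-verified Lean document; each statement's English description precedes it below -/
import Mathlib

section
/- Let σ ∈ S_n², let (i,j) and (i',j') be arcs of σ with i' < i < j < j', and suppose every arc (a,b) of σ other than (i,j) with i' < a < b < j' satisfies i < a < b < j. Let σ'' be the involution obtained from σ by replacing the two arcs (i',j'), (i,j) with the arcs (i',j) and (i,j'). Then σ'' ≺ σ, f(σ'') = f(σ), and c(σ'') = c(σ) + 1. -/
namespace LinkPat

variable {n : ℕ}

/-- `σ` is an involution (σ² = id). -/
def IsInvol (σ : Equiv.Perm (Fin n)) : Prop := ∀ p, σ (σ p) = p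

/-- `(i,j)` is an arc of `σ`: `i < j` and `σ i = j`. -/
def IsArc (σ : Equiv.Perm (Fin n)) (i j : Fin n) : Prop := i < j ∧ σ i = j

/-- The finite set of arcs of `σ`. -/
def arcs (σ : Equiv.Perm (Fin n)) : Finset (Fin n × Fin n) :=
  Finset.univ.filter fun a => a.1 < a.2 ∧ σ a.1 = a.2

/-- The number of arcs of `σ`. -/
def numArcs (σ : Equiv.Perm (Fin n)) : ℕ := (arcs σ).card

/-- `c(σ)`: the number of crossings, i.e. pairs of arcs `(i,j)`, `(i',j')` with
`i < i' < j < j'`. -/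
def crossNum (σ : Equiv.Perm (Fin n)) : ℕ :=
  ((arcs σ ×ˢ arcs σ).filter fun x => x.1.1 < x.2.1 ∧ x.2.1 < x.1.2 ∧ x.1.2 < x.2.2).card

/-- `f(σ)`: the sum over fixed points `p` of the number of arcs over `p`. -/
def fixNum (σ : Equiv.Perm (Fin n)) : ℕ :=
  (((Finset.univ.filter fun p => σ p = p) ×ˢ arcs σ).filter
    fun x => x.2.1 < x.1 ∧ x.1 < x.2.2).card

/-- The rank matrix `R_σ`: entry `(i,j)` is the number of arcs inside `[i,j]`. -/
def Rmat (σ : Equiv.Perm (Fin n)) (i j : Fin n) : ℕ :=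
  ((arcs σ).filter fun a => i ≤ a.1 ∧ a.2 ≤ j).card

/-- The partial order `σ' ⪯ σ` given by pointwise comparison of rank matrices. -/
def rle (σ' σ : Equiv.Perm (Fin n)) : Prop := ∀ i j, Rmat σ' i j ≤ Rmat σ i j

/-- The strict order `σ' ≺ σ`. -/
def rlt (σ' σ : Equiv.Perm (Fin n)) : Prop := rle σ' σ ∧ σ' ≠ σ

end LinkPat

namespace LinkPat

/-- The indicator that `x` and `y` cross, with `x` opening first. -/
def crossInd {n : ℕ} (x y : Fin n × Fin n) : ℕ :=
  if x.1 < y.1 ∧ y.1 < x.2 ∧ x.2 < y.2 then 1 else 0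

lemma crossNum_eq_sum {n : ℕ} (σ : Equiv.Perm (Fin n)) :
    crossNum σ = ∑ x ∈ arcs σ, ∑ y ∈ arcs σ, crossInd x y := by
  rw [crossNum, Finset.card_filter, Finset.sum_product]
  rfl

lemma fixNum_eq_sum {n : ℕ} (σ : Equiv.Perm (Fin n)) :
    fixNum σ = ∑ p ∈ Finset.univ.filter (fun p => σ p = p), ∑ a ∈ arcs σ,
      if a.1 < p ∧ p < a.2 then 1 else 0 := by
  rw [fixNum, Finset.card_filter, Finset.sum_product]

lemma Rmat_eq_sum {n : ℕ} (σ : Equiv.Perm (Fin n)) (i j : Fin n) :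
    Rmat σ i j = ∑ a ∈ arcs σ, if i ≤ a.1 ∧ a.2 ≤ j then 1 else 0 := by
  rw [Rmat, Finset.card_filter]

lemma sum_insert_pair {α : Type*} [DecidableEq α] {T : Finset α} {x y : α} (hxy : x ≠ y)
    (hx : x ∉ T) (hy : y ∉ T) (g : α → ℕ) :
    ∑ a ∈ insert x (insert y T), g a = g x + g y + ∑ a ∈ T, g a := by
  rw [Finset.sum_insert (by simp [hxy, hx]), Finset.sum_insert hy, add_assoc]

lemma sum_sum_insert_pair {α : Type*} [DecidableEq α] {T : Finset α} {x y : α} (hxy : x ≠ y)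
    (hx : x ∉ T) (hy : y ∉ T) (g : α → α → ℕ) :
    ∑ a ∈ insert x (insert y T), ∑ b ∈ insert x (insert y T), g a b =
      (g x x + g x y + g y x + g y y) + ∑ t ∈ T, (g x t + g t x + g y t + g t y) +
        ∑ a ∈ T, ∑ b ∈ T, g a b := by
  simp only [sum_insert_pair hxy hx hy, Finset.sum_add_distrib]
  ring

/-- The arcs of `σ` whose left endpoint is neither `i` nor `i'`. -/
def otherArcs {n : ℕ} (σ : Equiv.Perm (Fin n)) (i i' : Fin n) : Finset (Fin n × Fin n) :=
  (arcs σ).filter fun a => a.1 ≠ i ∧ a.1 ≠ i'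

lemma arcs_eq_insert {n : ℕ} {σ : Equiv.Perm (Fin n)} {i j i' j' : Fin n}
    (harc : IsArc σ i j) (harc' : IsArc σ i' j') :
    arcs σ = insert (i', j') (insert (i, j) (otherArcs σ i i')) := by
  obtain ⟨h, rfl⟩ := harc
  obtain ⟨h', rfl⟩ := harc'
  ext ⟨a, b⟩
  simp only [arcs, otherArcs, Finset.mem_filter, Finset.mem_univ, true_and, Finset.mem_insert,
    Prod.mk.injEq]
  grind

section Conj

variable {n : ℕ} {σ : Equiv.Perm (Fin n)} {i j i' j' : Fin n}

lemma conj_apply_of_ne (hσ : IsInvol σ) (hij : σ i = j) (hij' : σ i' = j') {a : Fin n}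
    (h1 : a ≠ i) (h2 : a ≠ i') (h3 : a ≠ j) (h4 : a ≠ j') :
    (Equiv.swap i i' * σ * Equiv.swap i i') a = σ a := by
  have h5 : σ a ≠ i := fun h => h3 (by rw [← hij, ← h, hσ])
  have h6 : σ a ≠ i' := fun h => h4 (by rw [← hij', ← h, hσ])
  simp [Equiv.swap_apply_of_ne_of_ne, *]

lemma conj_apply_left (hij' : σ i' = j') (h1 : j' ≠ i) (h2 : j' ≠ i') :
    (Equiv.swap i i' * σ * Equiv.swap i i') i = j' := by
  simp [hij', Equiv.swap_apply_of_ne_of_ne, h1, h2]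

lemma conj_apply_right (hσ : IsInvol σ) (hij : σ i = j) (h1 : j ≠ i) (h2 : j ≠ i') :
    (Equiv.swap i i' * σ * Equiv.swap i i') j = i' := by
  have : σ j = i := by rw [← hij, hσ]
  simp [this, Equiv.swap_apply_of_ne_of_ne, h1, h2]

end Conj

/-- An arc `t` crosses the nested pair `(i', j')`, `(i, j)` as often as the crossing pair
`(i', j)`, `(i, j')`, unless it joins the gap `(i', i)` to the gap `(j, j')`. -/
lemma crossInd_swap_left {n : ℕ} {i j i' j' : Fin n} {t : Fin n × Fin n} (hi : i' < i)
    (hij : i < j) (hj : j < j') (ht : t.1 < t.2) (h1 : t.1 ≠ i) (h2 : t.1 ≠ i') (h3 : t.1 ≠ j)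
    (h4 : t.1 ≠ j') (h5 : t.2 ≠ i) (h6 : t.2 ≠ i') (h7 : t.2 ≠ j) (h8 : t.2 ≠ j')
    (h : i' < t.1 → t.2 < j' → i < t.1 ∧ t.2 < j) :
    crossInd (i', j) t + crossInd t (i', j) + crossInd (i, j') t + crossInd t (i, j') =
      crossInd (i', j') t + crossInd t (i', j') + crossInd (i, j) t + crossInd t (i, j) := by
  obtain ⟨a, b⟩ := t
  simp only [crossInd]
  dsimp only at *
  split_ifs <;> first | rfl | (exfalso; omega)

end LinkPat

/-- crossing an arc `(i,j)` with an arc `(i',j')` directly above it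
(no other arc strictly between them) produces an involution `σ''` (with arcs
`(i',j)` and `(i,j')` instead of `(i',j')`, `(i,j)`, i.e. the conjugate of `σ` by
the transposition exchanging `i` and `i'`) which is strictly smaller, with the
same `f` and with `c` increased by exactly `1`. -/
theorem cross_over_move (n : ℕ) (σ σ'' : Equiv.Perm (Fin n))
    (hσ : LinkPat.IsInvol σ) (i j i' j' : Fin n)
    (harc : LinkPat.IsArc σ i j) (harc' : LinkPat.IsArc σ i' j')
    (hi : i' < i) (hj : j < j')
    (hbetween : ∀ a b : Fin n, LinkPat.IsArc σ a b → ¬(a = i ∧ b = j) →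
      i' < a → b < j' → i < a ∧ b < j)
    (hdef : σ'' = Equiv.swap i i' * σ * Equiv.swap i i') :
    LinkPat.rlt σ'' σ ∧ LinkPat.fixNum σ'' = LinkPat.fixNum σ ∧
      LinkPat.crossNum σ'' = LinkPat.crossNum σ + 1 := by
  obtain ⟨hlt, hij⟩ := id harc
  obtain ⟨hlt', hij'⟩ := id harc'
  have hji : σ j = i := by rw [← hij, hσ]
  have hji' : σ j' = i' := by rw [← hij', hσ]
  have ei : σ'' i = j' := by
    rw [hdef]; exact LinkPat.conj_apply_left hij' (by order) (by order)
  have ei' : σ'' i' = j := by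
    rw [hdef, Equiv.swap_comm]; exact LinkPat.conj_apply_left hij (by order) (by order)
  have ej : σ'' j = i' := by
    rw [hdef]; exact LinkPat.conj_apply_right hσ hij (by order) (by order)
  have ej' : σ'' j' = i := by
    rw [hdef, Equiv.swap_comm]; exact LinkPat.conj_apply_right hσ hij' (by order) (by order)
  have eo : ∀ a, a ≠ i → a ≠ i' → a ≠ j → a ≠ j' → σ'' a = σ a := fun a h1 h2 h3 h4 => by
    rw [hdef]; exact LinkPat.conj_apply_of_ne hσ hij hij' h1 h2 h3 h4
  have hother : LinkPat.otherArcs σ'' i i' = LinkPat.otherArcs σ i i' := by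
    ext ⟨a, b⟩
    simp only [LinkPat.otherArcs, LinkPat.arcs, Finset.mem_filter, Finset.mem_univ, true_and]
    by_cases h3 : a = j
    · subst h3; rw [ej, hji]; constructor <;> rintro ⟨⟨h, rfl⟩, -⟩ <;> order
    by_cases h4 : a = j'
    · subst h4; rw [ej', hji']; constructor <;> rintro ⟨⟨h, rfl⟩, -⟩ <;> order
    grind
  have hA : LinkPat.arcs σ = _ := LinkPat.arcs_eq_insert harc harc'
  have hA'' : LinkPat.arcs σ'' = _ :=
    LinkPat.arcs_eq_insert (σ := σ'') (i := i) (i' := i') ⟨by order, ei⟩ ⟨by order, ei'⟩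
  rw [hother] at hA''
  have hT : ∀ t ∈ LinkPat.otherArcs σ i i', t.1 < t.2 ∧ t.1 ≠ i ∧ t.1 ≠ i' ∧ t.1 ≠ j ∧ t.1 ≠ j' ∧
      t.2 ≠ i ∧ t.2 ≠ i' ∧ t.2 ≠ j ∧ t.2 ≠ j' ∧ (i' < t.1 → t.2 < j' → i < t.1 ∧ t.2 < j) := by
    rintro ⟨a, b⟩ ht
    simp only [LinkPat.otherArcs, LinkPat.arcs, Finset.mem_filter, Finset.mem_univ,
      true_and] at ht
    obtain ⟨⟨hab, rfl⟩, h1, h2⟩ := ht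
    have hb := hbetween a (σ a) ⟨hab, rfl⟩ (fun h => h1 h.1)
    have hs := hσ a
    refine ⟨hab, h1, h2, ?_, ?_, ?_, ?_, ?_, ?_, hb⟩ <;> dsimp only <;> intro h
    · rw [h, hji] at hab; order
    · rw [h, hji'] at hab; order
    · rw [h, hij] at hs; order
    · rw [h, hij'] at hs; order
    · rw [h, hji] at hs; exact h1 hs.symm
    · rw [h, hji'] at hs; exact h2 hs.symm
  generalize LinkPat.otherArcs σ i i' = T at hA hA'' hT
  have n1 : ∀ b, (i, b) ∉ T := fun b h => (hT _ h).2.1 rfl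
  have n2 : ∀ b, (i', b) ∉ T := fun b h => (hT _ h).2.2.1 rfl
  have n3 : ∀ b c : Fin n, (i', b) ≠ (i, c) := fun b c h => hi.ne (congrArg Prod.fst h)
  refine ⟨⟨fun x y => ?_, fun h => ?_⟩, ?_, ?_⟩
  · rw [LinkPat.Rmat_eq_sum, LinkPat.Rmat_eq_sum, hA, hA'',
      LinkPat.sum_insert_pair (n3 _ _) (n2 _) (n1 _),
      LinkPat.sum_insert_pair (n3 _ _) (n2 _) (n1 _)]
    gcongr ?_ + _
    dsimp only
    split_ifs <;> omega
  · rw [h, hij] at ei; order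
  · have hfix : ∀ p, σ'' p = p ↔ σ p = p := fun p => by
      by_cases h1 : p = i
      · subst h1; rw [ei, hij]; constructor <;> intro <;> order
      by_cases h2 : p = i'
      · subst h2; rw [ei', hij']; constructor <;> intro <;> order
      by_cases h3 : p = j
      · subst h3; rw [ej, hji]; constructor <;> intro <;> order
      by_cases h4 : p = j'
      · subst h4; rw [ej', hji']; constructor <;> intro <;> order
      rw [eo p h1 h2 h3 h4]
    rw [LinkPat.fixNum_eq_sum, LinkPat.fixNum_eq_sum]
    simp only [hfix, hA, hA'']
    refine Finset.sum_congr rfl fun p hp => ?_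
    rw [LinkPat.sum_insert_pair (n3 _ _) (n2 _) (n1 _),
      LinkPat.sum_insert_pair (n3 _ _) (n2 _) (n1 _)]
    congr 1
    have hp : σ p = p := by simpa using hp
    have p1 : p ≠ i := by rintro rfl; order
    have p2 : p ≠ j := by rintro rfl; order
    dsimp only
    split_ifs <;> omega
  · rw [LinkPat.crossNum_eq_sum, LinkPat.crossNum_eq_sum, hA, hA'',
      LinkPat.sum_sum_insert_pair (n3 _ _) (n2 _) (n1 _),
      LinkPat.sum_sum_insert_pair (n3 _ _) (n2 _) (n1 _)]
    have hmid : ∀ t ∈ T,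
        LinkPat.crossInd (i', j) t + LinkPat.crossInd t (i', j) + LinkPat.crossInd (i, j') t +
          LinkPat.crossInd t (i, j') =
        LinkPat.crossInd (i', j') t + LinkPat.crossInd t (i', j') + LinkPat.crossInd (i, j) t +
          LinkPat.crossInd t (i, j) := by
      intro t ht
      obtain ⟨h0, h1, h2, h3, h4, h5, h6, h7, h8, h9⟩ := hT t ht
      exact LinkPat.crossInd_swap_left hi hlt hj h0 h1 h2 h3 h4 h5 h6 h7 h8 h9
    rw [Finset.sum_congr rfl hmid]
    have hcorner : LinkPat.crossInd (i', j) (i', j) + LinkPat.crossInd (i', j) (i, j') +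
        LinkPat.crossInd (i, j') (i', j) + LinkPat.crossInd (i, j') (i, j') =
        LinkPat.crossInd (i', j') (i', j') + LinkPat.crossInd (i', j') (i, j) +
        LinkPat.crossInd (i, j) (i', j') + LinkPat.crossInd (i, j) (i, j) + 1 := by
      simp [LinkPat.crossInd, hi, hj, hlt, hj.not_gt, hi.not_gt]
    rw [hcorner]
    ring
end

section
/- For every k with 0 ≤ 2k ≤ n, the set S_n²(k) of involutions of S_n with exactly k arcs has a minimum element with respect to ⪯: there exists σ_o ∈ S_n²(k) such that σ_o ⪯ σ for every σ ∈ S_n²(k). -/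
namespace LinkPat

theorem mem_arcs {n : ℕ} {σ : Equiv.Perm (Fin n)} {a : Fin n × Fin n} :
    a ∈ arcs σ ↔ a.1 < a.2 ∧ σ a.1 = a.2 := by
  simp [arcs]

theorem injOn_fst_arcs {n : ℕ} (σ : Equiv.Perm (Fin n)) :
    Set.InjOn (fun a : Fin n × Fin n => (a.1 : ℕ)) (arcs σ) := by
  intro a ha b hb h
  have h₁ : a.1 = b.1 := Fin.ext h
  refine Prod.ext h₁ ?_
  rw [← (mem_arcs.1 ha).2, ← (mem_arcs.1 hb).2, h₁]

theorem injOn_snd_arcs {n : ℕ} (σ : Equiv.Perm (Fin n)) :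
    Set.InjOn (fun a : Fin n × Fin n => (a.2 : ℕ)) (arcs σ) := by
  intro a ha b hb h
  have h₂ : a.2 = b.2 := Fin.ext h
  refine Prod.ext (σ.injective ?_) h₂
  rw [(mem_arcs.1 ha).2, (mem_arcs.1 hb).2, h₂]

/-- An arc that is not inside `[i,j]` starts before `i` or ends after `j`. -/
theorem numArcs_le_Rmat_add {n : ℕ} (σ : Equiv.Perm (Fin n)) (i j : Fin n) :
    numArcs σ ≤ Rmat σ i j + i + (n - (j + 1)) := by
  have hcover : arcs σ ⊆ ((arcs σ).filter fun a => i ≤ a.1 ∧ a.2 ≤ j) ∪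
      ((arcs σ).filter fun a => a.1 < i) ∪ ((arcs σ).filter fun a => j < a.2) := by
    intro a ha
    simp only [Finset.mem_union, Finset.mem_filter, ha, true_and]
    grind
  have hleft : ((arcs σ).filter fun a => a.1 < i).card ≤ i := by
    simpa using Finset.card_le_card_of_injOn (t := Finset.range i) (fun a => (a.1 : ℕ))
      (fun a ha => by simpa using (Finset.mem_filter.1 ha).2)
      ((injOn_fst_arcs σ).mono (Finset.coe_subset.2 (Finset.filter_subset _ _)))
  have hright : ((arcs σ).filter fun a => j < a.2).card ≤ n - (j + 1) := by
    simpa using Finset.card_le_card_of_injOn (t := Finset.Ico (j + 1 : ℕ) n)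
      (fun a => (a.2 : ℕ))
      (fun a ha => by
        have h : j < a.2 := (Finset.mem_filter.1 ha).2
        simpa [Nat.succ_le_iff] using h)
      ((injOn_snd_arcs σ).mono (Finset.coe_subset.2 (Finset.filter_subset _ _)))
  calc numArcs σ ≤ _ := Finset.card_le_card hcover
    _ ≤ _ := (Finset.card_union_le _ _).trans
      (Nat.add_le_add_right (Finset.card_union_le _ _) _)
    _ ≤ _ := by unfold Rmat; lia

/-- The map exchanging `p` and `p + (n - k)` for every `p < k`. -/
def endSwapFun {n k : ℕ} (hkn : 2 * k ≤ n) (p : Fin n) : Fin n :=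
  if h : (p : ℕ) < k then ⟨p + (n - k), by lia⟩
  else if n - k ≤ p then ⟨p - (n - k), by lia⟩ else p

theorem endSwapFun_involutive {n k : ℕ} (hkn : 2 * k ≤ n) :
    Function.Involutive (endSwapFun hkn) := by
  intro p
  ext
  simp only [endSwapFun]
  grind

/-- The involution whose arcs are `(p, p + (n - k))` for `p < k`. -/
def endSwap {n k : ℕ} (hkn : 2 * k ≤ n) : Equiv.Perm (Fin n) :=
  (endSwapFun_involutive hkn).toPerm

theorem mem_arcs_endSwap {n k : ℕ} (hkn : 2 * k ≤ n) {a : Fin n × Fin n} :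
    a ∈ arcs (endSwap hkn) ↔ (a.1 : ℕ) < k ∧ (a.2 : ℕ) = a.1 + (n - k) := by
  rw [mem_arcs, Fin.lt_def, Fin.ext_iff]
  simp only [endSwap, Function.Involutive.coe_toPerm, endSwapFun]
  grind

theorem numArcs_endSwap {n k : ℕ} (hkn : 2 * k ≤ n) : numArcs (endSwap hkn) = k := by
  refine (Finset.card_nbij (t := Finset.range k) (fun a => (a.1 : ℕ)) ?_
    (injOn_fst_arcs _) ?_).trans (Finset.card_range k)
  · intro a ha
    simpa using ((mem_arcs_endSwap hkn).1 ha).1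
  · intro p hp
    have hp : p < k := by simpa using hp
    exact ⟨(⟨p, by lia⟩, ⟨p + (n - k), by lia⟩), (mem_arcs_endSwap hkn).2 ⟨hp, rfl⟩, rfl⟩

theorem Rmat_endSwap_le {n k : ℕ} (hkn : 2 * k ≤ n) (i j : Fin n) :
    Rmat (endSwap hkn) i j ≤ j + 1 + k - n - i := by
  rw [← Nat.card_Ico]
  refine Finset.card_le_card_of_injOn (fun a => (a.1 : ℕ)) ?_
    ((injOn_fst_arcs _).mono (Finset.coe_subset.2 (Finset.filter_subset _ _)))
  intro a ha
  obtain ⟨ha, hi, hj⟩ := Finset.mem_filter.1 ha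
  have h := (mem_arcs_endSwap hkn).1 ha
  rw [Fin.le_def] at hi hj
  simp only [Finset.coe_Ico, Set.mem_Ico]
  lia

end LinkPat

/-- for `0 ≤ 2k ≤ n`, the set `S_n²(k)` of involutions with exactly
`k` arcs has a minimum element with respect to `⪯`. -/
theorem exists_min_involution (n k : ℕ) (hkn : 2 * k ≤ n) :
    ∃ σo : Equiv.Perm (Fin n), LinkPat.IsInvol σo ∧ LinkPat.numArcs σo = k ∧
      ∀ σ : Equiv.Perm (Fin n), LinkPat.IsInvol σ → LinkPat.numArcs σ = k →
        LinkPat.rle σo σ := by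
  refine ⟨LinkPat.endSwap hkn, LinkPat.endSwapFun_involutive hkn,
    LinkPat.numArcs_endSwap hkn, fun σ _ hσ i j => ?_⟩
  have hupper := LinkPat.Rmat_endSwap_le hkn i j
  have hlower := LinkPat.numArcs_le_Rmat_add σ i j
  lia
end
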